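/- Let n be a positive integer divisible by 4 and let Γ = IOCG_n(D,σ) be an integral oriented circulant graph with Hermitian eigenvalues μ_0,…,μ_{n−1} (indices read modulo n). Suppose that for every b ∈ Z_n, Γ has perfect state transfer between b + n/2 and b. Then Γ has perfect state transfer between b + n/4 and b for every b ∈ Z_n if and only if there exists a nonnegative integer m' such that for every j = 0, 1, …, n−1 one has μ_{j+2} − μ_j ≠ 0 and ν₂(μ_{j+2} − μ_j) = m'. -/

import Mathlib

open Complex Finset

noncomputable section

/-- `G_n^r(d) = { dk : k ≡ r (mod 4), gcd(dk, n) = d } ⊆ {1, …, n−1}`. -/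
def Gsetr (n r d : ℕ) : Finset ℕ :=
  (Finset.range n).filter (fun a => d ∣ a ∧ (a / d) % 4 = r ∧ Nat.gcd a n = d)

/-- The symbol `C = ⋃_{d ∈ D} S_n(d)` of the integral oriented circulant graph
`IOCG_n(D, σ)`, where `S_n(d) = G_n^1(d)` if `σ d = 1` and `S_n(d) = G_n^3(d)` otherwise. -/
def symbol (n : ℕ) (D : Finset ℕ) (σ : ℕ → ℤ) : Finset ℕ :=
  D.biUnion (fun d => Gsetr n (if σ d = 1 then 1 else 3) d)

/-- The Hermitian adjacency matrix of the oriented circulant graph with symbol `C`. -/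
def hermMatrix (n : ℕ) [NeZero n] (C : Finset ℕ) : Matrix (ZMod n) (ZMod n) ℂ :=
  Matrix.of fun u v =>
    if (v - u).val ∈ C then Complex.I
    else if (u - v).val ∈ C then -Complex.I else 0

/-- The transition matrix `U(t) = exp(i t H)`. -/
def transitionMatrix (n : ℕ) [NeZero n] (C : Finset ℕ) (t : ℝ) :
    Matrix (ZMod n) (ZMod n) ℂ :=
  NormedSpace.exp ((Complex.I * (t : ℂ)) • hermMatrix n C)

/-- Perfect state transfer from `u` to `v`. -/
def hasPST (n : ℕ) [NeZero n] (C : Finset ℕ) (u v : ZMod n) : Prop :=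
  ∃ (t : ℝ) (γ : ℂ), ‖γ‖ = 1 ∧
    (transitionMatrix n C t).mulVec (Pi.single u 1) = γ • (Pi.single v 1 : ZMod n → ℂ)

/-- Multiple state transfer on a vertex set `S`: PST between every pair of
distinct vertices of `S`. -/
def hasMST (n : ℕ) [NeZero n] (C : Finset ℕ) (S : Set (ZMod n)) : Prop :=
  ∀ u ∈ S, ∀ v ∈ S, u ≠ v → hasPST n C u v

/-- The Hermitian eigenvalues `μ_j = i ∑_{k ∈ C} (ω^{jk} − ω^{−jk})`, `ω = exp(2πi/n)`. -/
def eigval (n : ℕ) (C : Finset ℕ) (j : ℕ) : ℂ :=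
  Complex.I * ∑ k ∈ C, (Complex.exp (2 * Real.pi * Complex.I * j * k / n) -
    Complex.exp (-(2 * Real.pi * Complex.I * j * k / n)))

/-- Ramanujan's sum `c_n(q) = ∑_{1 ≤ a ≤ n, gcd(a,n)=1} exp(2πi a q / n)`. -/
def ramanujanSum (n q : ℕ) : ℂ :=
  ∑ a ∈ (Finset.Icc 1 n).filter (fun a => Nat.gcd a n = 1),
    Complex.exp (2 * Real.pi * Complex.I * a * q / n)

/-- Ramanujan's sine sum `s_n(q) = i ∑_{a ∈ G_n^1(1)} (ω^{aq} − ω^{−aq})`. -/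
def sineSum (n q : ℕ) : ℂ :=
  Complex.I * ∑ a ∈ Gsetr n 1 1, (Complex.exp (2 * Real.pi * Complex.I * a * q / n) -
    Complex.exp (-(2 * Real.pi * Complex.I * a * q / n)))

/-- A symbol coming from divisors of `n / 4` is disjoint from its negative. -/
lemma symbol_neg_val_notMem {n : ℕ} [NeZero n] (hn4 : 4 ∣ n) {D : Finset ℕ}
    (hD : ∀ d ∈ D, d ∣ n / 4) (σ : ℕ → ℤ) {w : ZMod n} (hw : w.val ∈ symbol n D σ) :
    (-w).val ∉ symbol n D σ := by
  intro hw'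
  simp only [symbol, Gsetr, Finset.mem_biUnion, Finset.mem_filter, Finset.mem_range] at hw hw'
  obtain ⟨d, hd, ha, ⟨k, hk⟩, hr, hg⟩ := hw
  obtain ⟨d', -, -, -, hr', hg'⟩ := hw'
  have hn : n ≠ 0 := NeZero.ne n
  rw [ZMod.neg_val] at hr' hg'
  by_cases h0 : w = 0
  · rw [if_pos h0, Nat.zero_div] at hr'
    split_ifs at hr'
  · rw [if_neg h0] at hr' hg'
    rw [Nat.gcd_self_sub_left ha.le] at hg'
    obtain rfl : d' = d := hg'.symm.trans hg
    obtain ⟨e, he⟩ := hD _ hd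
    have hne : n = d' * (4 * e) := by
      rw [← Nat.div_mul_cancel hn4, he]; ring
    have hd0 : 0 < d' := Nat.pos_of_ne_zero (by rintro rfl; simp at hne; exact hn hne)
    have hlt : k < 4 * e := by
      rw [hk] at ha
      exact Nat.lt_of_mul_lt_mul_left (ha.trans_eq hne)
    have h1 : (n - w.val) / d' = 4 * e - k := by
      rw [hk]
      conv_lhs => rw [hne]
      rw [← Nat.mul_sub, Nat.mul_div_cancel_left _ hd0]
    rw [h1] at hr'
    rw [hk, Nat.mul_div_cancel_left _ hd0] at hr
    split_ifs at hr hr' <;> omega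

lemma symbol_lt {n : ℕ} {D : Finset ℕ} {σ : ℕ → ℤ} {k : ℕ} (hk : k ∈ symbol n D σ) : k < n := by
  simp only [symbol, Gsetr, Finset.mem_biUnion, Finset.mem_filter, Finset.mem_range] at hk
  obtain ⟨d, -, h, -⟩ := hk
  exact h

/-- The Hermitian eigenvalue attached to a character of `ZMod n`. -/
def charEigval (n : ℕ) [NeZero n] (C : Finset ℕ) (x : ZMod n) : ℂ :=
  Complex.I * ∑ k ∈ C, (ZMod.stdAddChar ((k : ZMod n) * x) - ZMod.stdAddChar (-((k : ZMod n) * x)))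

lemma charEigval_natCast (n : ℕ) [NeZero n] (C : Finset ℕ) (j : ℕ) :
    charEigval n C (j : ZMod n) = eigval n C j := by
  unfold charEigval eigval
  congr 1
  refine Finset.sum_congr rfl fun k _ => ?_
  have h1 : ((k : ZMod n) * (j : ZMod n)) = (((k * j : ℕ) : ℤ) : ZMod n) := by push_cast; rfl
  have h2 : -((k : ZMod n) * (j : ZMod n)) = ((-((k * j : ℕ) : ℤ) : ℤ) : ZMod n) := by
    push_cast; rfl
  rw [h2, h1, ZMod.stdAddChar_coe, ZMod.stdAddChar_coe]
  congr 2 <;> push_cast <;> ring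

lemma charEigval_neg (n : ℕ) [NeZero n] (C : Finset ℕ) (x : ZMod n) :
    charEigval n C (-x) = -charEigval n C x := by
  unfold charEigval
  rw [← mul_neg, ← Finset.sum_neg_distrib]
  simp

lemma sum_ite_val_mem {n : ℕ} [NeZero n] {C : Finset ℕ} (hC : ∀ k ∈ C, k < n) (f : ZMod n → ℂ) :
    ∑ w : ZMod n, (if w.val ∈ C then f w else 0) = ∑ k ∈ C, f (k : ZMod n) := by
  rw [← Finset.sum_filter]
  refine Finset.sum_nbij' (fun w => w.val) (fun k => (k : ZMod n)) ?_ ?_ ?_ ?_ ?_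
  · intro w hw; simpa using hw
  · intro k hk; simpa [ZMod.val_cast_of_lt (hC k hk)] using hk
  · intro w _; simp
  · intro k hk; exact ZMod.val_cast_of_lt (hC k hk)
  · intro w _; simp

/-- The matrix of the discrete Fourier transform. -/
def dftMatrix (n : ℕ) [NeZero n] : Matrix (ZMod n) (ZMod n) ℂ :=
  Matrix.of fun x u => ZMod.stdAddChar (-(u * x))

lemma dftMatrix_mulVec_injective (n : ℕ) [NeZero n] :
    Function.Injective (dftMatrix n).mulVec := by
  have h : (dftMatrix n).mulVec = (ZMod.dft : (ZMod n → ℂ) ≃ₗ[ℂ] (ZMod n → ℂ)) := by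
    ext w x
    rw [ZMod.dft_apply]
    simp [Matrix.mulVec, dotProduct, dftMatrix]
  rw [h]
  exact ZMod.dft.injective

lemma dftMatrix_mul_hermMatrix {n : ℕ} [NeZero n] {C : Finset ℕ} (hC : ∀ k ∈ C, k < n)
    (hdisj : ∀ w : ZMod n, w.val ∈ C → (-w).val ∉ C) :
    dftMatrix n * hermMatrix n C = Matrix.diagonal (charEigval n C) * dftMatrix n := by
  ext x v
  rw [Matrix.mul_apply, Matrix.diagonal_mul]
  simp only [dftMatrix, hermMatrix, Matrix.of_apply]
  rw [← (Equiv.subLeft v).sum_comp]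
  have key : ∀ w : ZMod n,
      ZMod.stdAddChar (-((Equiv.subLeft v) w * x)) *
        (if (v - (Equiv.subLeft v) w).val ∈ C then Complex.I
          else if ((Equiv.subLeft v) w - v).val ∈ C then -Complex.I else 0) =
      ZMod.stdAddChar (-(v * x)) * (Complex.I *
        ((if w.val ∈ C then ZMod.stdAddChar (w * x) else 0) -
          (if (-w).val ∈ C then ZMod.stdAddChar (w * x) else 0))) := by
    intro w
    have e1 : v - (Equiv.subLeft v) w = w := by simp
    have e2 : (Equiv.subLeft v) w - v = -w := by simp
    have e3 : -((Equiv.subLeft v) w * x) = -(v * x) + w * x := by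
      simp only [Equiv.subLeft_apply]; ring
    rw [e1, e2, e3, AddChar.map_add_eq_mul]
    by_cases h : w.val ∈ C
    · simp [h, hdisj w h]; ring
    · by_cases h' : (-w).val ∈ C
      · simp [h, h']; ring
      · simp [h, h']
  rw [Finset.sum_congr rfl fun w _ => key w, ← Finset.mul_sum, ← Finset.mul_sum,
    Finset.sum_sub_distrib, mul_comm, charEigval, Finset.sum_sub_distrib,
    sum_ite_val_mem hC fun w => ZMod.stdAddChar (w * x),
    ← Equiv.sum_comp (Equiv.neg (ZMod n))
      fun w : ZMod n => if (-w).val ∈ C then ZMod.stdAddChar (w * x) else (0 : ℂ)]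
  simp only [Equiv.neg_apply, neg_neg, neg_mul]
  rw [sum_ite_val_mem hC fun w => ZMod.stdAddChar (-(w * x))]

open scoped Matrix.Norms.Operator in
lemma mul_exp_eq_exp_mul {m : Type*} [Fintype m] [DecidableEq m] {F A B : Matrix m m ℂ}
    (h : F * A = B * F) : F * NormedSpace.exp A = NormedSpace.exp B * F :=
  SemiconjBy.exp_right (x := F) (a := A) (b := B) h

lemma hasPST_iff_forall_exp {n : ℕ} [NeZero n] {C : Finset ℕ} (hC : ∀ k ∈ C, k < n)
    (hdisj : ∀ w : ZMod n, w.val ∈ C → (-w).val ∉ C) (u v : ZMod n) :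
    hasPST n C u v ↔ ∃ (t : ℝ) (γ : ℂ), ‖γ‖ = 1 ∧ ∀ x : ZMod n,
      Complex.exp (Complex.I * t * charEigval n C x) * ZMod.stdAddChar (-(u * x)) =
        γ * ZMod.stdAddChar (-(v * x)) := by
  unfold hasPST
  refine exists_congr fun t => exists_congr fun γ => and_congr_right fun _ => ?_
  rw [← (dftMatrix_mulVec_injective n).eq_iff, funext_iff]
  refine forall_congr' fun x => ?_
  have h : dftMatrix n * transitionMatrix n C t =
      Matrix.diagonal (fun x => Complex.exp (Complex.I * t * charEigval n C x)) *
        dftMatrix n := by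
    have h' := mul_exp_eq_exp_mul (F := dftMatrix n) (A := (Complex.I * (t : ℂ)) • hermMatrix n C)
      (B := (Complex.I * (t : ℂ)) • Matrix.diagonal (charEigval n C)) (by
        rw [Matrix.mul_smul, dftMatrix_mul_hermMatrix hC hdisj, Matrix.smul_mul])
    rw [← Matrix.diagonal_smul, Matrix.exp_diagonal] at h'
    rw [transitionMatrix, h']
    congr 2
    ext y
    rw [Pi.coe_exp, Complex.exp_eq_exp_ℂ]
    simp
  rw [Matrix.mulVec_mulVec, h, Matrix.mulVec_smul]
  simp [dftMatrix]

lemma hasPST_add_iff {n : ℕ} [NeZero n] {C : Finset ℕ} (hC : ∀ k ∈ C, k < n)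
    (hdisj : ∀ w : ZMod n, w.val ∈ C → (-w).val ∉ C) (b s : ZMod n) :
    hasPST n C (b + s) b ↔ ∃ t : ℝ, ∀ x : ZMod n,
      Complex.exp (Complex.I * t * charEigval n C x) = ZMod.stdAddChar (s * x) := by
  have hsplit (x : ZMod n) : (ZMod.stdAddChar (-(b * x)) : ℂ) =
      ZMod.stdAddChar (s * x) * ZMod.stdAddChar (-((b + s) * x)) := by
    rw [← AddChar.map_add_eq_mul]; congr 1; ring
  rw [hasPST_iff_forall_exp hC hdisj]
  refine exists_congr fun t => ⟨?_, fun h => ⟨1, by simp, fun x => ?_⟩⟩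
  · rintro ⟨γ, -, h⟩ x
    have hγ : γ = 1 := by simpa [charEigval] using (h 0).symm
    have hx := h x
    rw [hγ, one_mul, hsplit x] at hx
    have hne : (ZMod.stdAddChar (-((b + s) * x)) : ℂ) ≠ 0 := by
      rw [ZMod.stdAddChar_apply]; exact Circle.coe_ne_zero _
    exact mul_right_cancel₀ hne hx
  · rw [h, one_mul, hsplit x]

lemma exists_odd_mul_eq_odd_mul {x y : ℤ} (hx : x ≠ 0) (hy : y ≠ 0)
    (h : padicValInt 2 x = padicValInt 2 y) : ∃ a b : ℤ, Odd a ∧ Odd b ∧ x * a = y * b := by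
  have key : ∀ z : ℤ, z ≠ 0 → ∃ c : ℤ, Odd c ∧ z = 2 ^ padicValInt 2 z * c := by
    intro z hz
    obtain ⟨c, hc⟩ := padicValInt_dvd (p := 2) z
    refine ⟨c, ?_, by exact_mod_cast hc⟩
    rw [← Int.not_even_iff_odd, even_iff_two_dvd]
    rintro ⟨d, rfl⟩
    have hdvd : ((2 : ℕ) : ℤ) ^ (padicValInt 2 z + 1) ∣ z :=
      ⟨d, by conv_lhs => rw [hc]
             push_cast; ring⟩
    rw [padicValInt_dvd_iff] at hdvd
    rcases hdvd with h0 | h0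
    · exact hz h0
    · omega
  obtain ⟨c, hc, hxc⟩ := key x hx
  obtain ⟨d, hd, hyd⟩ := key y hy
  refine ⟨d, c, hd, hc, ?_⟩
  rw [hxc, hyd, h]; ring

lemma padicValInt_two_eq_of_odd_mul {x y a b : ℤ} (hx : x ≠ 0) (hy : y ≠ 0) (ha : Odd a)
    (hb : Odd b) (h : x * a = y * b) : padicValInt 2 x = padicValInt 2 y := by
  have ha0 : a ≠ 0 := by rintro rfl; simp at ha
  have hb0 : b ≠ 0 := by rintro rfl; simp at hb
  have hv := congrArg (padicValInt 2) h
  rw [padicValInt.mul hx ha0, padicValInt.mul hy hb0] at hv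
  have odd_val : ∀ z : ℤ, Odd z → padicValInt 2 z = 0 := fun z hz =>
    padicValInt.eq_zero_of_not_dvd (by
      rw [← Int.not_even_iff_odd, even_iff_two_dvd] at hz; exact_mod_cast hz)
  simpa [odd_val a ha, odd_val b hb] using hv

lemma exists_odd_of_exp_eq_neg_one {t : ℝ} {x : ℤ}
    (h : Complex.exp (Complex.I * t * x) = -1) : ∃ a : ℤ, Odd a ∧ t * x = a * Real.pi := by
  rw [← Complex.exp_pi_mul_I, Complex.exp_eq_exp_iff_exists_int] at h
  obtain ⟨k, hk⟩ := h
  refine ⟨2 * k + 1, ⟨k, rfl⟩, ?_⟩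
  have h2 : Complex.I * ((t * x : ℝ) : ℂ) =
      Complex.I * (((2 * k + 1 : ℤ) * Real.pi : ℝ) : ℂ) := by
    push_cast
    linear_combination hk
  exact_mod_cast mul_left_cancel₀ Complex.I_ne_zero h2

lemma padicValInt_two_eq_of_exp_eq_neg_one {t : ℝ} {x y : ℤ}
    (hx : Complex.exp (Complex.I * t * x) = -1) (hy : Complex.exp (Complex.I * t * y) = -1) :
    padicValInt 2 x = padicValInt 2 y := by
  have ne_zero : ∀ z : ℤ, Complex.exp (Complex.I * t * z) = -1 → z ≠ 0 := by
    rintro z hz rfl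
    norm_num at hz
  obtain ⟨a, ha, hxa⟩ := exists_odd_of_exp_eq_neg_one hx
  obtain ⟨b, hb, hyb⟩ := exists_odd_of_exp_eq_neg_one hy
  refine padicValInt_two_eq_of_odd_mul (ne_zero x hx) (ne_zero y hy) hb ha ?_
  have ht : t * Real.pi ≠ 0 := by
    refine mul_ne_zero ?_ Real.pi_ne_zero
    rintro rfl
    norm_num at hx
  have : (x * b : ℝ) = y * a := by
    refine mul_left_cancel₀ ht ?_
    linear_combination (b * Real.pi) * hxa - (a * Real.pi) * hyb
  exact_mod_cast this

lemma exp_eq_neg_one_of_padicValInt_two_eq {t : ℝ} {x y : ℤ} (hx0 : x ≠ 0) (hy0 : y ≠ 0)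
    (h : padicValInt 2 x = padicValInt 2 y) (hx : Complex.exp (Complex.I * t * x) = -1)
    (hy : Complex.exp (Complex.I * t * y) ^ 2 = 1) : Complex.exp (Complex.I * t * y) = -1 := by
  obtain ⟨a, b, ha, hb, hab⟩ := exists_odd_mul_eq_odd_mul hx0 hy0 h
  rcases mul_self_eq_one_iff.mp ((sq _).symm.trans hy) with h1 | h1
  · exfalso
    have e : Complex.exp (Complex.I * t * x) ^ a = Complex.exp (Complex.I * t * y) ^ b := by
      rw [← Complex.exp_int_mul, ← Complex.exp_int_mul]
      congr 1
      have : (x * a : ℂ) = y * b := by exact_mod_cast hab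
      linear_combination (Complex.I * t) * this
    rw [hx, h1, one_zpow, ha.neg_one_zpow] at e
    norm_num at e
  · exact h1

lemma stdAddChar_quarter {n : ℕ} [NeZero n] (hn4 : 4 ∣ n) :
    (ZMod.stdAddChar ((n / 4 : ℕ) : ZMod n) : ℂ) = Complex.I := by
  have hn : (n : ℂ) ≠ 0 := by exact_mod_cast NeZero.ne n
  have h : ((n / 4 : ℕ) : ZMod n) = (((n / 4 : ℕ) : ℤ) : ZMod n) :=
    (Int.cast_natCast _).symm
  have harg : 2 * Real.pi * Complex.I * (((n / 4 : ℕ) : ℤ) : ℂ) / n = Real.pi / 2 * Complex.I := by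
    rw [Int.cast_natCast, Nat.cast_div hn4 (by norm_num)]
    push_cast
    field_simp
    norm_num
  rw [h, ZMod.stdAddChar_coe, harg, Complex.exp_pi_div_two_mul_I]

lemma stdAddChar_quarter_mul_add_two {n : ℕ} [NeZero n] (hn4 : 4 ∣ n) (x : ZMod n) :
    (ZMod.stdAddChar (((n / 4 : ℕ) : ZMod n) * (x + 2)) : ℂ) =
      -ZMod.stdAddChar (((n / 4 : ℕ) : ZMod n) * x) := by
  rw [show ((n / 4 : ℕ) : ZMod n) * (x + 2) = ((n / 4 : ℕ) : ZMod n) * x +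
      (((n / 4 : ℕ) : ZMod n) + ((n / 4 : ℕ) : ZMod n)) by ring, AddChar.map_add_eq_mul,
    AddChar.map_add_eq_mul, stdAddChar_quarter hn4, Complex.I_mul_I, mul_neg_one]

lemma stdAddChar_half_mul {n : ℕ} [NeZero n] (hn4 : 4 ∣ n) (x : ZMod n) :
    (ZMod.stdAddChar (((n / 2 : ℕ) : ZMod n) * x) : ℂ) =
      ZMod.stdAddChar (((n / 4 : ℕ) : ZMod n) * x) ^ 2 := by
  rw [sq, ← AddChar.map_add_eq_mul, ← add_mul, ← Nat.cast_add,
    show n / 2 = n / 4 + n / 4 by omega]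

lemma exists_forall_exp_eq_quarter {n : ℕ} [NeZero n] (hn4 : 4 ∣ n) {f : ZMod n → ℤ}
    (hf : ∀ x, f (-x) = -f x) {t : ℝ}
    (ht : ∀ x, Complex.exp (Complex.I * t * f x) =
      ZMod.stdAddChar (((n / 2 : ℕ) : ZMod n) * x))
    (hne : ∀ x, f (x + 2) - f x ≠ 0)
    (hval : ∀ x y, padicValInt 2 (f (x + 2) - f x) = padicValInt 2 (f (y + 2) - f y)) :
    ∃ s : ℝ, ∀ x, Complex.exp (Complex.I * s * f x) =
      ZMod.stdAddChar (((n / 4 : ℕ) : ZMod n) * x) := by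
  have hf0 : f 0 = 0 := by have := hf 0; rw [neg_zero] at this; omega
  have hchar : ∀ x : ZMod n, (ZMod.stdAddChar (((n / 4 : ℕ) : ZMod n) * x) : ℂ) ≠ 0 := fun x => by
    rw [ZMod.stdAddChar_apply]; exact Circle.coe_ne_zero _
  obtain ⟨s, hs2, hs1⟩ : ∃ s : ℝ, (∀ x, Complex.exp (Complex.I * s * f x) ^ 2 =
      ZMod.stdAddChar (((n / 4 : ℕ) : ZMod n) * x) ^ 2) ∧
      Complex.exp (Complex.I * s * f 1) = Complex.I := by
    have hpos : ∀ x, Complex.exp (Complex.I * (t / 2 : ℝ) * f x) ^ 2 =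
        ZMod.stdAddChar (((n / 4 : ℕ) : ZMod n) * x) ^ 2 := by
      intro x
      rw [← stdAddChar_half_mul hn4, ← ht, ← Complex.exp_nat_mul]
      congr 1; push_cast; ring
    have h1 := hpos 1
    rw [mul_one, stdAddChar_quarter hn4] at h1
    rcases sq_eq_sq_iff_eq_or_eq_neg.mp h1 with h | h
    · exact ⟨t / 2, hpos, h⟩
    · refine ⟨-(t / 2), fun x => ?_, ?_⟩
      · have := hpos (-x)
        rw [hf] at this
        rw [mul_neg, AddChar.map_neg_eq_inv, inv_pow] at this
        have h4 : (ZMod.stdAddChar (((n / 4 : ℕ) : ZMod n) * x) : ℂ) ^ 4 = 1 := by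
          have h4n : (4 : ℕ) • (((n / 4 : ℕ) : ZMod n) * x) = 0 := by
            rw [nsmul_eq_mul, ← mul_assoc, ← Nat.cast_mul, Nat.mul_div_cancel' hn4]
            simp
          rw [← AddChar.map_nsmul_eq_pow, h4n, AddChar.map_zero_eq_one]
        have harg : Complex.I * ((-(t / 2) : ℝ) : ℂ) * f x =
            Complex.I * ((t / 2 : ℝ) : ℂ) * ((-f x : ℤ) : ℂ) := by push_cast; ring
        rw [harg, this]
        exact inv_eq_of_mul_eq_one_left (by rw [← pow_add]; exact h4)
      · have harg : Complex.I * ((-(t / 2) : ℝ) : ℂ) * f 1 =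
            -(Complex.I * ((t / 2 : ℝ) : ℂ) * f 1) := by push_cast; ring
        rw [harg, Complex.exp_neg, h, inv_neg, Complex.inv_I, neg_neg]
  refine ⟨s, ?_⟩
  have hbase : Complex.exp (Complex.I * s * (f (-1 + 2) - f (-1) : ℤ)) = -1 := by
    have : f (-1 + 2) - f (-1) = 2 * f 1 := by
      rw [hf, show (-1 + 2 : ZMod n) = 1 by ring]; ring
    have hsq : Complex.exp (Complex.I * s * f 1) ^ 2 = -1 := by rw [hs1, Complex.I_sq]
    rw [this, ← hsq, ← Complex.exp_nat_mul]
    congr 1; push_cast; ring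
  have hdiff : ∀ x, Complex.exp (Complex.I * s * (f (x + 2) - f x : ℤ)) =
      Complex.exp (Complex.I * s * f (x + 2)) / Complex.exp (Complex.I * s * f x) := by
    intro x
    rw [← Complex.exp_sub]; congr 1; push_cast; ring
  have hstep : ∀ x, Complex.exp (Complex.I * s * f (x + 2)) =
      -Complex.exp (Complex.I * s * f x) := by
    intro x
    have := exp_eq_neg_one_of_padicValInt_two_eq (hne (-1)) (hne x) (hval _ _) hbase (by
      rw [hdiff, div_pow, hs2, hs2, stdAddChar_quarter_mul_add_two hn4, neg_sq,
        div_self (pow_ne_zero 2 (hchar x))])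
    rw [hdiff, div_eq_iff (Complex.exp_ne_zero _)] at this
    rw [this, neg_one_mul]
  have hnat : ∀ k : ℕ, Complex.exp (Complex.I * s * f (k : ZMod n)) =
      ZMod.stdAddChar (((n / 4 : ℕ) : ZMod n) * (k : ZMod n)) := by
    intro k
    induction k using Nat.twoStepInduction with
    | zero => simp [hf0]
    | one => rw [Nat.cast_one, hs1, mul_one, stdAddChar_quarter hn4]
    | more k ih _ =>
      rw [Nat.cast_add, Nat.cast_two, hstep, ih, stdAddChar_quarter_mul_add_two hn4]
  intro x
  simpa using hnat x.val

theorem pst_quarter_iff_val_const (n : ℕ) [NeZero n] (hn4 : 4 ∣ n)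
    (D : Finset ℕ) (hD : ∀ d ∈ D, d ∣ n / 4)
    (σ : ℕ → ℤ) (hσ : ∀ d ∈ D, σ d = 1 ∨ σ d = -1)
    (μ : ℕ → ℤ) (hμ : ∀ j < n, (μ j : ℂ) = eigval n (symbol n D σ) j)
    (hhalf : ∀ b : ZMod n, hasPST n (symbol n D σ) (b + (n / 2 : ℕ)) b) :
    (∀ b : ZMod n, hasPST n (symbol n D σ) (b + (n / 4 : ℕ)) b) ↔
      ∃ m' : ℕ, ∀ j < n, μ ((j + 2) % n) - μ j ≠ 0 ∧
        padicValInt 2 (μ ((j + 2) % n) - μ j) = m' := by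
  have hpst := hasPST_add_iff (C := symbol n D σ) (fun _ => symbol_lt)
    (fun _ => symbol_neg_val_notMem hn4 hD σ)
  have hL : ∀ x : ZMod n, charEigval n (symbol n D σ) x = (μ x.val : ℂ) := by
    intro x
    rw [hμ _ x.val_lt, ← charEigval_natCast]
    simp
  simp only [hpst, hL, forall_const] at hhalf ⊢
  have hneg : ∀ x : ZMod n, μ (-x).val = -μ x.val := by
    intro x
    have := charEigval_neg n (symbol n D σ) x
    rw [hL, hL] at this
    exact_mod_cast this
  have hval : ∀ j < n, (j : ZMod n).val = j := fun j => ZMod.val_cast_of_lt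
  have hval2 : ∀ j : ℕ, ((j : ZMod n) + 2).val = (j + 2) % n := fun j => by
    rw [← ZMod.val_natCast n (j + 2)]; push_cast; rfl
  obtain ⟨t, ht⟩ := hhalf
  constructor
  · rintro ⟨s, hs⟩
    have hexp : ∀ x : ZMod n,
        Complex.exp (Complex.I * s * (μ (x + 2).val - μ x.val : ℤ)) = -1 := by
      intro x
      rw [Int.cast_sub, mul_sub, Complex.exp_sub, div_eq_iff (Complex.exp_ne_zero _), hs, hs,
        stdAddChar_quarter_mul_add_two hn4, neg_one_mul]
    refine ⟨padicValInt 2 (μ ((0 : ZMod n) + 2).val - μ (0 : ZMod n).val), fun j hj => ?_⟩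
    have hj' := hexp j
    rw [hval j hj, hval2] at hj'
    refine ⟨fun h0 => ?_, padicValInt_two_eq_of_exp_eq_neg_one hj' (hexp 0)⟩
    rw [h0] at hj'
    norm_num at hj'
  · rintro ⟨m', hm⟩
    have hm' : ∀ x : ZMod n, μ (x + 2).val - μ x.val ≠ 0 ∧
        padicValInt 2 (μ (x + 2).val - μ x.val) = m' := by
      intro x
      have := hm x.val x.val_lt
      rwa [← hval2, ZMod.natCast_zmod_val] at this
    exact exists_forall_exp_eq_quarter hn4 (f := fun x => μ x.val) hneg ht
      (fun x => (hm' x).1) (fun x y => (hm' x).2.trans (hm' y).2.symm)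

end
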